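/- The conjecture of Lucchesi and Murty fails: for every positive integer N there exists an integer n ≥ N and a brick on n vertices that has strictly fewer than n − 1 perfect matchings. -/

import Mathlib

open SimpleGraph

/-- The number of perfect matchings of a graph. -/
noncomputable def numPM {V : Type*} (G : SimpleGraph V) : ℕ :=
  Set.ncard {M : G.Subgraph | M.IsPerfectMatching}

/-- A graph is 3-connected if it has at least 4 vertices and deleting any set of at most
two vertices leaves a connected graph. -/
def ThreeConnected {V : Type*} [Fintype V] (G : SimpleGraph V) : Prop :=
  4 ≤ Fintype.card V ∧
    ∀ s : Set V, s.ncard ≤ 2 → (G.induce (sᶜ : Set V)).Connected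

/-- A brick: a 3-connected graph such that deleting any two distinct vertices leaves
a graph with a perfect matching (Edmonds–Lovász–Pulleyblank characterization). -/
def IsBrick {V : Type*} [Fintype V] (G : SimpleGraph V) : Prop :=
  ThreeConnected G ∧
    ∀ x y : V, x ≠ y →
      ∃ M : (G.induce {v : V | v ≠ x ∧ v ≠ y}).Subgraph, M.IsPerfectMatching

/-- A brick is extremal when its number of perfect matchings equals |E| - |V| + 1. -/
def IsExtremal {V : Type*} [Fintype V] (G : SimpleGraph V) : Prop :=
  numPM G + Fintype.card V = G.edgeSet.ncard + 1

/-- Oriented edges of the counterexample on vertices `0, …, 2k+3`. The rim is the cycle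
`0, 1, …, 2k+2`, with the extra chord `0 — 2k+1`, and the hub `2k+3` is joined to all rim
vertices but `0` and `2k+1`. -/
def cexE (k a b : ℕ) : Prop :=
  (b = a + 1 ∧ b ≤ 2 * k + 2) ∨ (a = 0 ∧ (b = 2 * k + 1 ∨ b = 2 * k + 2)) ∨
    (b = 2 * k + 3 ∧ 1 ≤ a ∧ a ≠ 2 * k + 1 ∧ a ≤ 2 * k + 2)

/-- The symmetric adjacency relation. -/
def cexA (k a b : ℕ) : Prop := cexE k a b ∨ cexE k b a

/-- The counterexample. -/
def cexG (k : ℕ) (hk : 1 ≤ k) : SimpleGraph (Fin (2 * k + 4)) where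
  Adj a b := cexA k a b
  symm := ⟨fun _ _ h => Or.symm h⟩
  loopless := ⟨fun a h => by
    have := a.2
    unfold cexA cexE at h
    omega⟩

theorem three_not_mem {V : Type*} [Finite V] (s : Set V) (hs : s.ncard ≤ 2) (a b c : V)
    (hab : a ≠ b) (hac : a ≠ c) (hbc : b ≠ c) (ha : a ∈ s) (hb : b ∈ s) (hc : c ∈ s) : False := by
  have h3 : ({a, b, c} : Set V).ncard = 3 := Set.ncard_eq_three.2 ⟨a, b, c, hab, hac, hbc, rfl⟩
  have : ({a, b, c} : Set V) ⊆ s := by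
    intro z hz
    rcases hz with rfl | rfl | rfl <;> assumption
  have := Set.ncard_le_ncard this (Set.toFinite s)
  omega

/-- `p` is a partner function off the vertices `u` and `v`. -/
def PartnerOff (k u v : ℕ) (p : ℕ → ℕ) : Prop :=
  ∀ w, w < 2 * k + 4 → w ≠ u → w ≠ v →
      p w < 2 * k + 4 ∧ p w ≠ u ∧ p w ≠ v ∧ p (p w) = w ∧ cexA k w (p w)

theorem ex_reorder (a b c d e : Prop) (h : (a ∧ b ∧ c ∧ e) ∧ d) : a ∧ b ∧ c ∧ d ∧ e := by
  tauto

theorem partner_caseA (k : ℕ) (hk : 1 ≤ k) (a b : ℕ) (h : 2 * a < 2 * b) (h' : 2 * b < 2 * k + 2) :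
    ∃ p, PartnerOff k (2 * a) (2 * b) p := by
  obtain ⟨p, hp⟩ : ∃ p : ℕ → ℕ, ∀ w, p w = (
          if w = 2 * k + 3 then 2 * a + 1 else if w = 2 * a + 1 then 2 * k + 3 else
          if w < 2 * b then (if w % 2 = 0 then w + 1 else w - 1) else
          (if w % 2 = 1 then w + 1 else w - 1)) := ⟨_, fun _ => rfl⟩
  refine ⟨p, fun w h1 h2 h3 => ex_reorder _ _ _ _ _ ?_⟩
  have e1 := hp w
  have e2 := hp (p w)
  generalize p (p w) = z at *
  generalize p w = y at *
  clear hp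
  constructor
  · clear e2
    unfold cexA cexE
    split_ifs at e1 <;> (refine ⟨?_, ?_, ?_, ?_⟩ <;> omega)
  · split_ifs at e1 <;> split_ifs at e2 <;> omega

theorem partner_caseB (k : ℕ) (hk : 1 ≤ k) (a b : ℕ) (h : 2 * a + 1 < 2 * b + 1) (h' : 2 * b + 1 < 2 * k + 2) :
    ∃ p, PartnerOff k (2 * a + 1) (2 * b + 1) p := by
  obtain ⟨p, hp⟩ : ∃ p : ℕ → ℕ, ∀ w, p w = (
          if w = 2 * k + 3 then 2 * a + 2 else if w = 2 * a + 2 then 2 * k + 3 else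
          if w = 2 * k + 2 then 0 else if w = 0 then 2 * k + 2 else
          if w < 2 * b + 1 then (if w % 2 = 1 then w + 1 else w - 1) else
          (if w % 2 = 0 then w + 1 else w - 1)) := ⟨_, fun _ => rfl⟩
  refine ⟨p, fun w h1 h2 h3 => ex_reorder _ _ _ _ _ ?_⟩
  have e1 := hp w
  have e2 := hp (p w)
  generalize p (p w) = z at *
  generalize p w = y at *
  clear hp
  constructor
  · clear e2
    unfold cexA cexE
    split_ifs at e1 <;> (refine ⟨?_, ?_, ?_, ?_⟩ <;> omega)
  · split_ifs at e1 <;> split_ifs at e2 <;> omega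

theorem partner_caseC (k : ℕ) (hk : 1 ≤ k) (a b : ℕ) (h : 2 * a < 2 * b + 1) (h' : 2 * b + 1 < 2 * k + 2) :
    ∃ p, PartnerOff k (2 * a) (2 * b + 1) p := by
  obtain ⟨p, hp⟩ : ∃ p : ℕ → ℕ, ∀ w, p w = (
          if w = 2 * k + 3 then 2 * k + 2 else if w = 2 * k + 2 then 2 * k + 3 else
          if w < 2 * a then (if w % 2 = 0 then w + 1 else w - 1) else
          if w < 2 * b + 1 then (if w % 2 = 1 then w + 1 else w - 1) else
          (if w % 2 = 0 then w + 1 else w - 1)) := ⟨_, fun _ => rfl⟩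
  refine ⟨p, fun w h1 h2 h3 => ex_reorder _ _ _ _ _ ?_⟩
  have e1 := hp w
  have e2 := hp (p w)
  generalize p (p w) = z at *
  generalize p w = y at *
  clear hp
  constructor
  · clear e2
    unfold cexA cexE
    split_ifs at e1 <;> (refine ⟨?_, ?_, ?_, ?_⟩ <;> omega)
  · split_ifs at e1 <;> split_ifs at e2 <;> omega

set_option maxHeartbeats 1000000 in
theorem partner_caseD (k : ℕ) (hk : 1 ≤ k) (a b : ℕ) (h : 2 * a + 1 < 2 * b) (h' : 2 * b < 2 * k + 2) :
    ∃ p, PartnerOff k (2 * a + 1) (2 * b) p := by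
  obtain ⟨p, hp⟩ : ∃ p : ℕ → ℕ, ∀ w, p w = (
          if w = 2 * k + 3 then 2 * k + 2 else if w = 2 * k + 2 then 2 * k + 3 else
          if w = 0 then 2 * k + 1 else if w = 2 * k + 1 then 0 else
          if w < 2 * a + 1 then (if w % 2 = 1 then w + 1 else w - 1) else
          if w < 2 * b then (if w % 2 = 0 then w + 1 else w - 1) else
          (if w % 2 = 1 then w + 1 else w - 1)) := ⟨_, fun _ => rfl⟩
  refine ⟨p, fun w h1 h2 h3 => ex_reorder _ _ _ _ _ ?_⟩
  have e1 := hp w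
  have e2 := hp (p w)
  generalize p (p w) = z at *
  generalize p w = y at *
  clear hp
  constructor
  · clear e2
    unfold cexA cexE
    split_ifs at e1 <;> (refine ⟨?_, ?_, ?_, ?_⟩ <;> omega)
  · split_ifs at e1 <;> split_ifs at e2 <;> omega

theorem partner_caseE (k : ℕ) (hk : 1 ≤ k)  :
    ∃ p, PartnerOff k (0) (2 * k + 2) p := by
  obtain ⟨p, hp⟩ : ∃ p : ℕ → ℕ, ∀ w, p w = (
          if w = 2 * k + 3 then 1 else if w = 1 then 2 * k + 3 else
          (if w % 2 = 0 then w + 1 else w - 1)) := ⟨_, fun _ => rfl⟩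
  refine ⟨p, fun w h1 h2 h3 => ex_reorder _ _ _ _ _ ?_⟩
  have e1 := hp w
  have e2 := hp (p w)
  generalize p (p w) = z at *
  generalize p w = y at *
  clear hp
  constructor
  · clear e2
    unfold cexA cexE
    split_ifs at e1 <;> (refine ⟨?_, ?_, ?_, ?_⟩ <;> omega)
  · split_ifs at e1 <;> split_ifs at e2 <;> omega

theorem partner_caseF (k : ℕ) (hk : 1 ≤ k)  :
    ∃ p, PartnerOff k (2 * k + 1) (2 * k + 2) p := by
  obtain ⟨p, hp⟩ : ∃ p : ℕ → ℕ, ∀ w, p w = (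
          if w = 2 * k + 3 then 2 * k else if w = 2 * k then 2 * k + 3 else
          (if w % 2 = 0 then w + 1 else w - 1)) := ⟨_, fun _ => rfl⟩
  refine ⟨p, fun w h1 h2 h3 => ex_reorder _ _ _ _ _ ?_⟩
  have e1 := hp w
  have e2 := hp (p w)
  generalize p (p w) = z at *
  generalize p w = y at *
  clear hp
  constructor
  · clear e2
    unfold cexA cexE
    split_ifs at e1 <;> (refine ⟨?_, ?_, ?_, ?_⟩ <;> omega)
  · split_ifs at e1 <;> split_ifs at e2 <;> omega

theorem partner_caseG (k : ℕ) (hk : 1 ≤ k) (a : ℕ) (h : 0 < 2 * a) (h' : 2 * a < 2 * k + 1) :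
    ∃ p, PartnerOff k (2 * a) (2 * k + 2) p := by
  obtain ⟨p, hp⟩ : ∃ p : ℕ → ℕ, ∀ w, p w = (
          if w = 2 * k + 3 then 1 else if w = 1 then 2 * k + 3 else
          if w = 0 then 2 * k + 1 else if w = 2 * k + 1 then 0 else
          if w < 2 * a then (if w % 2 = 0 then w + 1 else w - 1) else
          (if w % 2 = 1 then w + 1 else w - 1)) := ⟨_, fun _ => rfl⟩
  refine ⟨p, fun w h1 h2 h3 => ex_reorder _ _ _ _ _ ?_⟩
  have e1 := hp w
  have e2 := hp (p w)
  generalize p (p w) = z at *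
  generalize p w = y at *
  clear hp
  constructor
  · clear e2
    unfold cexA cexE
    split_ifs at e1 <;> (refine ⟨?_, ?_, ?_, ?_⟩ <;> omega)
  · split_ifs at e1 <;> split_ifs at e2 <;> omega

theorem partner_caseI (k : ℕ) (hk : 1 ≤ k) (a : ℕ) (h' : 2 * a + 1 < 2 * k + 1) :
    ∃ p, PartnerOff k (2 * a + 1) (2 * k + 2) p := by
  obtain ⟨p, hp⟩ : ∃ p : ℕ → ℕ, ∀ w, p w = (
          if w = 2 * k + 3 then 2 * a + 2 else if w = 2 * a + 2 then 2 * k + 3 else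
          if w = 0 then 2 * k + 1 else if w = 2 * k + 1 then 0 else
          (if w % 2 = 1 then w + 1 else w - 1)) := ⟨_, fun _ => rfl⟩
  refine ⟨p, fun w h1 h2 h3 => ex_reorder _ _ _ _ _ ?_⟩
  have e1 := hp w
  have e2 := hp (p w)
  generalize p (p w) = z at *
  generalize p w = y at *
  clear hp
  constructor
  · clear e2
    unfold cexA cexE
    split_ifs at e1 <;> (refine ⟨?_, ?_, ?_, ?_⟩ <;> omega)
  · split_ifs at e1 <;> split_ifs at e2 <;> omega

theorem partner_caseJ (k : ℕ) (hk : 1 ≤ k) (a : ℕ) (h' : 2 * a < 2 * k + 3) :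
    ∃ p, PartnerOff k (2 * a) (2 * k + 3) p := by
  obtain ⟨p, hp⟩ : ∃ p : ℕ → ℕ, ∀ w, p w = (
          if w < 2 * a then (if w % 2 = 0 then w + 1 else w - 1) else
          (if w % 2 = 1 then w + 1 else w - 1)) := ⟨_, fun _ => rfl⟩
  refine ⟨p, fun w h1 h2 h3 => ex_reorder _ _ _ _ _ ?_⟩
  have e1 := hp w
  have e2 := hp (p w)
  generalize p (p w) = z at *
  generalize p w = y at *
  clear hp
  constructor
  · clear e2
    unfold cexA cexE
    split_ifs at e1 <;> (refine ⟨?_, ?_, ?_, ?_⟩ <;> omega)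
  · split_ifs at e1 <;> split_ifs at e2 <;> omega

theorem partner_caseK (k : ℕ) (hk : 1 ≤ k) (a : ℕ) (h' : 2 * a + 1 < 2 * k + 3) :
    ∃ p, PartnerOff k (2 * a + 1) (2 * k + 3) p := by
  obtain ⟨p, hp⟩ : ∃ p : ℕ → ℕ, ∀ w, p w = (
          if w = 0 then 2 * k + 2 else if w = 2 * k + 2 then 0 else
          if w < 2 * a + 1 then (if w % 2 = 1 then w + 1 else w - 1) else
          (if w % 2 = 0 then w + 1 else w - 1)) := ⟨_, fun _ => rfl⟩
  refine ⟨p, fun w h1 h2 h3 => ex_reorder _ _ _ _ _ ?_⟩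
  have e1 := hp w
  have e2 := hp (p w)
  generalize p (p w) = z at *
  generalize p w = y at *
  clear hp
  constructor
  · clear e2
    unfold cexA cexE
    split_ifs at e1 <;> (refine ⟨?_, ?_, ?_, ?_⟩ <;> omega)
  · split_ifs at e1 <;> split_ifs at e2 <;> omega

/-- The matching part, in terms of natural numbers. -/
theorem cex_partner (k : ℕ) (hk : 1 ≤ k) (u v : ℕ) (huv : u < v) (hv : v < 2 * k + 4) :
    ∃ p, PartnerOff k u v p := by
  obtain ⟨a, ha⟩ : ∃ a, u = 2 * a ∨ u = 2 * a + 1 := ⟨u / 2, by omega⟩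
  obtain ⟨b, hb⟩ : ∃ b, v = 2 * b ∨ v = 2 * b + 1 := ⟨v / 2, by omega⟩
  rcases Nat.lt_trichotomy v (2 * k + 2) with h | h | h
  · rcases ha with rfl | rfl <;> rcases hb with rfl | rfl
    · exact partner_caseA k hk a b huv h
    · exact partner_caseC k hk a b huv h
    · exact partner_caseD k hk a b huv h
    · exact partner_caseB k hk a b huv h
  · subst h
    by_cases h0 : u = 0
    · subst h0; exact partner_caseE k hk
    by_cases hL : u = 2 * k + 1
    · subst hL; exact partner_caseF k hk
    rcases ha with rfl | rfl
    · exact partner_caseG k hk a (by omega) (by omega)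
    · exact partner_caseI k hk a (by omega)
  · obtain rfl : v = 2 * k + 3 := by omega
    rcases ha with rfl | rfl
    · exact partner_caseJ k hk a huv
    · exact partner_caseK k hk a huv

theorem cex_bicritical (k : ℕ) (hk : 1 ≤ k) (x y : Fin (2 * k + 4)) (hxy : x ≠ y) :
    ∃ M : ((cexG k hk).induce {v | v ≠ x ∧ v ≠ y}).Subgraph, M.IsPerfectMatching := by
  have key : ∃ p : ℕ → ℕ, ∀ w, w < 2 * k + 4 → w ≠ x → w ≠ y →
      p w < 2 * k + 4 ∧ p w ≠ x ∧ p w ≠ y ∧ p (p w) = w ∧ cexA k w (p w) := by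
    have hne : (x : ℕ) ≠ y := fun h => hxy (Fin.ext h)
    rcases Nat.lt_or_gt_of_ne hne with h | h
    · exact cex_partner k hk x y h y.2
    · obtain ⟨p, hp⟩ := cex_partner k hk y x h x.2
      refine ⟨p, fun w h1 h2 h3 => ?_⟩
      obtain ⟨a, b, c, d, e⟩ := hp w h1 h3 h2
      exact ⟨a, c, b, d, e⟩
  obtain ⟨p, hp⟩ := key
  have hp' : ∀ w : {v : Fin (2 * k + 4) | v ≠ x ∧ v ≠ y}, _ := fun w =>
    hp w.1 w.1.2 (fun h => w.2.1 (Fin.ext h)) (fun h => w.2.2 (Fin.ext h))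
  refine ⟨⟨Set.univ, fun a b => (b.1 : ℕ) = p a.1, ?_, fun _ => trivial, ⟨?_⟩⟩, ?_, ?_⟩
  · intro a b h
    have := (hp' a).2.2.2.2
    change cexA k a.1 b.1
    rw [h]
    exact this
  · intro a b h
    rw [h]
    exact (hp' a).2.2.2.1.symm
  · intro w _
    obtain ⟨h1, h2, h3, _, _⟩ := hp' w
    refine ⟨⟨⟨p w.1, h1⟩, ?_, ?_⟩, rfl, ?_⟩
    · exact fun h => h2 (congrArg Fin.val h)
    · exact fun h => h3 (congrArg Fin.val h)
    · intro z hz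
      exact Subtype.ext (Fin.ext hz)
  · intro w
    trivial

theorem cex_connected (k : ℕ) (hk : 1 ≤ k) (s : Set (Fin (2 * k + 4))) (hs : s.ncard ≤ 2) :
    ((cexG k hk).induce (sᶜ : Set _)).Connected := by
  -- translate to predicates on ℕ
  let F : ℕ → Prop := fun a => ∃ h : a < 2 * k + 4, (⟨a, h⟩ : Fin (2 * k + 4)) ∉ s
  let R : ℕ → ℕ → Prop := fun a b => ∃ (ha : a < 2 * k + 4) (hb : b < 2 * k + 4)
    (ha' : (⟨a, ha⟩ : Fin (2 * k + 4)) ∈ sᶜ) (hb' : (⟨b, hb⟩ : Fin (2 * k + 4)) ∈ sᶜ),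
    ((cexG k hk).induce (sᶜ : Set _)).Reachable ⟨_, ha'⟩ ⟨_, hb'⟩
  have hF : ∀ a b c, a < 2 * k + 4 → b < 2 * k + 4 → c < 2 * k + 4 → a ≠ b → a ≠ c → b ≠ c →
      F a ∨ F b ∨ F c := by
    intro a b c ha hb hc h1 h2 h3
    by_contra hcon
    simp only [F, not_or, not_exists, not_not] at hcon
    exact three_not_mem s hs ⟨a, ha⟩ ⟨b, hb⟩ ⟨c, hc⟩ (by simpa using h1) (by simpa using h2)
      (by simpa using h3) (hcon.1 ha) (hcon.2.1 hb) (hcon.2.2 hc)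
  have Rrefl : ∀ a, F a → R a a := fun a ⟨h, h'⟩ => ⟨h, h, h', h', SimpleGraph.Reachable.refl _⟩
  have Rsymm : ∀ a b, R a b → R b a := fun a b ⟨h1, h2, h3, h4, h5⟩ => ⟨h2, h1, h4, h3, h5.symm⟩
  have Rtrans : ∀ a b c, R a b → R b c → R a c := fun a b c ⟨h1, h2, h3, h4, h5⟩
    ⟨_, h2', _, h4', h5'⟩ => ⟨h1, h2', h3, h4', h5.trans h5'⟩
  have Radj : ∀ a b, F a → F b → cexA k a b → R a b := fun a b ⟨h1, h1'⟩ ⟨h2, h2'⟩ h =>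
    ⟨h1, h2, h1', h2', SimpleGraph.Adj.reachable (by exact h)⟩
  suffices hroot : ∃ r, F r ∧ ∀ c, F c → R r c by
    obtain ⟨r, ⟨hr, hr'⟩, h⟩ := hroot
    rw [SimpleGraph.connected_iff_exists_forall_reachable]
    refine ⟨⟨⟨r, hr⟩, hr'⟩, fun w => ?_⟩
    obtain ⟨_, _, _, _, h5⟩ := h w.1 ⟨w.1.2, w.2⟩
    exact h5
  have Flt : ∀ a, F a → a < 2 * k + 4 := fun a h => h.1
  clear_value F R
  have Rint : ∀ d a, a + d ≤ 2 * k + 2 → (∀ t, a ≤ t → t ≤ a + d → F t) → R a (a + d) := by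
    intro d
    induction d with
    | zero => intro a _ h; exact Rrefl a (h a le_rfl le_rfl)
    | succ d ih =>
      intro a h1 h2
      refine Rtrans _ (a + d) _ (ih a (by omega) (fun t h h' => h2 t h (by omega))) ?_
      refine Radj _ _ (h2 _ (by omega) (by omega)) (h2 _ (by omega) (by omega)) ?_
      unfold cexA cexE
      omega
  have Rint' : ∀ a b, a ≤ b → b ≤ 2 * k + 2 → (∀ t, a ≤ t → t ≤ b → F t) → R a b := by
    intro a b hab hb h
    obtain ⟨d, rfl⟩ := Nat.exists_eq_add_of_le hab
    exact Rint d a hb h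
  by_cases hh : F (2 * k + 3)
  · refine ⟨_, hh, fun c hc => ?_⟩
    have hlt := Flt c hc
    by_cases c3 : c = 2 * k + 3
    · subst c3; exact Rrefl _ hc
    apply Rsymm
    have hub : ∀ d, F d → 1 ≤ d → d ≠ 2 * k + 1 → d ≤ 2 * k + 2 → R d (2 * k + 3) := by
      intro d hd h1 h2 h3
      exact Radj _ _ hd hh (by unfold cexA cexE; omega)
    by_cases c0 : c = 0
    · subst c0
      by_cases f1 : F 1
      · exact Rtrans _ _ _ (Radj _ 1 hc f1 (by unfold cexA cexE; omega))
          (hub 1 f1 (by omega) (by omega) (by omega))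
      by_cases f2 : F (2 * k + 2)
      · exact Rtrans _ _ _ (Radj _ _ hc f2 (by unfold cexA cexE; omega))
          (hub _ f2 (by omega) (by omega) (by omega))
      have f3 : F (2 * k + 1) := by
        have := hF 1 (2 * k + 2) (2 * k + 1) (by omega) (by omega) (by omega) (by omega)
          (by omega) (by omega)
        tauto
      have f4 : F (2 * k) := by
        have := hF 1 (2 * k + 2) (2 * k) (by omega) (by omega) (by omega) (by omega)
          (by omega) (by omega)
        tauto
      exact Rtrans _ _ _ (Radj _ _ hc f3 (by unfold cexA cexE; omega))
        (Rtrans _ _ _ (Radj _ _ f3 f4 (by unfold cexA cexE; omega))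
          (hub _ f4 (by omega) (by omega) (by omega)))
    by_cases c1 : c = 2 * k + 1
    · subst c1
      by_cases f1 : F (2 * k)
      · exact Rtrans _ _ _ (Radj _ _ hc f1 (by unfold cexA cexE; omega))
          (hub _ f1 (by omega) (by omega) (by omega))
      by_cases f2 : F (2 * k + 2)
      · exact Rtrans _ _ _ (Radj _ _ hc f2 (by unfold cexA cexE; omega))
          (hub _ f2 (by omega) (by omega) (by omega))
      have f3 : F 0 := by
        have := hF (2 * k) (2 * k + 2) 0 (by omega) (by omega) (by omega) (by omega)
          (by omega) (by omega)
        tauto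
      have f4 : F 1 := by
        have := hF (2 * k) (2 * k + 2) 1 (by omega) (by omega) (by omega) (by omega)
          (by omega) (by omega)
        tauto
      exact Rtrans _ _ _ (Radj _ _ hc f3 (by unfold cexA cexE; omega))
        (Rtrans _ _ _ (Radj _ _ f3 f4 (by unfold cexA cexE; omega))
          (hub _ f4 (by omega) (by omega) (by omega)))
    exact hub c hc (by omega) c1 (by omega)
  · have hF2 : ∀ a b, a < 2 * k + 3 → b < 2 * k + 3 → a ≠ b → ¬ F a → F b := by
      intro a b ha hb hab hna
      have := hF (2 * k + 3) a b (by omega) (by omega) (by omega) (by omega) (by omega) hab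
      tauto
    have hle : ∀ c, F c → c ≤ 2 * k + 2 := by
      intro c hc
      have h1 := Flt c hc
      have h2 : c ≠ 2 * k + 3 := by rintro rfl; exact hh hc
      omega
    by_cases hx : F (2 * k + 2)
    · refine ⟨_, hx, fun c hc => Rsymm _ _ ?_⟩
      have := hle c hc
      by_cases hall : ∀ t, c ≤ t → t ≤ 2 * k + 2 → F t
      · exact Rint' _ _ this le_rfl hall
      · push Not at hall
        obtain ⟨u, hu1, hu2, hu3⟩ := hall
        have hcu : c ≠ u := by rintro rfl; exact hu3 hc
        have f0 : F 0 := hF2 u 0 (by omega) (by omega) (by omega) hu3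
        refine Rtrans _ 0 _ (Rsymm _ _ (Rint' 0 c (by omega) this ?_))
          (Radj _ _ f0 hx (by unfold cexA cexE; omega))
        intro t _ ht
        exact hF2 u t (by omega) (by omega) (by omega) hu3
    · refine ⟨0, hF2 _ 0 (by omega) (by omega) (by omega) hx, fun c hc => ?_⟩
      have h1 := hle c hc
      have h2 : c ≠ 2 * k + 2 := by rintro rfl; exact hx hc
      exact Rint' 0 c (by omega) h1
        (fun t _ ht => hF2 (2 * k + 2) t (by omega) (by omega) (by omega) hx)

/-- `p` is the partner function of a perfect matching. -/
def IsPartner (k : ℕ) (p : ℕ → ℕ) : Prop :=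
  ∀ w, w < 2 * k + 4 → p w < 2 * k + 4 ∧ p (p w) = w ∧ cexA k w (p w)

theorem partner_parity (k : ℕ) (hk : 1 ≤ k) (p : ℕ → ℕ) (hp : IsPartner k p)
    (i : ℕ) (hi1 : 1 ≤ i) (hi2 : i ≤ 2 * k) (hi : p (2 * k + 3) = i) :
    (p 0 = 1 ∧ i % 2 = 0) ∨ (p 0 = 2 * k + 2 ∧ i % 2 = 1) := by
  unfold IsPartner cexA cexE at hp
  have h0 := hp 0 (by omega)
  have hx := hp (2 * k + 2) (by omega)
  have hh := hp (2 * k + 3) (by omega)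
  have hpi : p i = 2 * k + 3 := by rw [← hi]; exact hh.2.1
  have h0' : p 0 = 1 ∨ p 0 = 2 * k + 2 := by
    by_contra hcon
    have h1 : p 0 = 2 * k + 1 := by omega
    have h2 : p (2 * k + 1) = 0 := by rw [← h1]; exact h0.2.1
    have : p (2 * k + 2) = 0 ∨ p (2 * k + 2) = 2 * k + 1 ∨ p (2 * k + 2) = 2 * k + 3 := by omega
    rcases this with h | h | h <;> (have h3 := hx.2.1; rw [h] at h3; omega)
  have step : ∀ j, j + 1 < i → (p j = j + 1 → p (j + 1) = j) ∧
      (p j ≠ j + 1 → p (j + 1) = j + 2) := by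
    intro j hj
    have h1 := hp j (by omega)
    have h2 := hp (j + 1) (by omega)
    constructor
    · intro h
      rw [← h]; exact h1.2.1
    · intro h
      have : p (j + 1) = j ∨ p (j + 1) = j + 2 ∨ p (j + 1) = 2 * k + 3 := by omega
      rcases this with h' | h' | h'
      · have h3 := h2.2.1; rw [h'] at h3; omega
      · exact h'
      · have h3 := h2.2.1; rw [h'] at h3; omega
  have hlast : p (i - 1) ≠ i := by
    intro h
    have h3 := (hp (i - 1) (by omega)).2.1
    rw [h] at h3
    omega
  rcases h0' with h | h
  · left
    refine ⟨h, ?_⟩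
    have : ∀ j, j < i → (p j = j + 1 ↔ j % 2 = 0) := by
      intro j
      induction j with
      | zero => intro _; simp [h]
      | succ j ih =>
        intro hj
        have := ih (by omega)
        have := step j hj
        omega
    have := this (i - 1) (by omega)
    omega
  · right
    refine ⟨h, ?_⟩
    have : ∀ j, j < i → (p j = j + 1 ↔ j % 2 = 1) := by
      intro j
      induction j with
      | zero => intro _; simp [h]
      | succ j ih =>
        intro hj
        have := ih (by omega)
        have := step j hj
        omega
    have := this (i - 1) (by omega)
    omega

theorem partner_unique (k : ℕ) (hk : 1 ≤ k) (p q : ℕ → ℕ) (hp : IsPartner k p)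
    (hq : IsPartner k q) (h0 : p 0 = q 0) (hh : p (2 * k + 3) = q (2 * k + 3)) :
    ∀ w, w < 2 * k + 4 → p w = q w := by
  unfold IsPartner cexA cexE at hp hq
  -- transfer of a pair
  have tr : ∀ j, j < 2 * k + 4 → ∀ t, t < 2 * k + 4 → p t = q t → (p j = t ↔ q j = t) := by
    intro j hj t ht h
    constructor
    · intro h'
      have h1 := (hp j hj).2.1
      rw [h', h] at h1
      have h2 := (hq t ht).2.1
      rw [h1] at h2
      exact h2
    · intro h'
      have h1 := (hq j hj).2.1
      rw [h', ← h] at h1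
      have h2 := (hp t ht).2.1
      rw [h1] at h2
      exact h2
  intro w
  induction w with
  | zero => intro _; exact h0
  | succ j ih =>
    intro hj
    by_cases hj3 : j + 1 = 2 * k + 3
    · rw [hj3]; exact hh
    have t1 := tr (j + 1) hj j (by omega) (ih (by omega))
    have t2 := tr (j + 1) hj 0 (by omega) h0
    have t3 := tr (j + 1) hj (2 * k + 3) (by omega) hh
    have a1 := (hp (j + 1) hj).2.2
    have a2 := (hq (j + 1) hj).2.2
    omega

theorem cex_numPM (k : ℕ) (hk : 1 ≤ k) : numPM (cexG k hk) ≤ 2 * k + 2 := by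
  classical
  have hex : ∀ M : (cexG k hk).Subgraph, ∃ p : ℕ → ℕ, M.IsPerfectMatching →
      IsPartner k p ∧ ∀ a b : Fin (2 * k + 4), M.Adj a b ↔ (b : ℕ) = p a := by
    intro M
    by_cases hM : M.IsPerfectMatching
    · have hM' := SimpleGraph.Subgraph.isPerfectMatching_iff.1 hM
      choose f hf hf' using hM'
      have hff : ∀ a, f (f a) = a := fun a => (hf' (f a) a (hf a).symm).symm
      refine ⟨fun w => if h : w < 2 * k + 4 then (f ⟨w, h⟩ : ℕ) else 0, fun _ => ⟨?_, ?_⟩⟩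
      · intro w hw
        simp only [hw, dif_pos, Fin.is_lt, Fin.eta, hff, true_and]
        exact (hf ⟨w, hw⟩).adj_sub
      · intro a b
        simp only [Fin.is_lt, dif_pos, Fin.eta]
        constructor
        · intro h; rw [hf' a b h]
        · intro h; rw [Fin.ext h]; exact hf a
    · exact ⟨id, fun h => absurd h hM⟩
  choose P hP using hex
  let key : (cexG k hk).Subgraph → ℕ := fun M =>
    if P M (2 * k + 3) = 2 * k + 2 ∧ P M 0 = 1 then 0 else P M (2 * k + 3)
  have hub : ∀ M, M.IsPerfectMatching →
      P M (2 * k + 3) = 2 * k + 2 ∨ (1 ≤ P M (2 * k + 3) ∧ P M (2 * k + 3) ≤ 2 * k) := by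
    intro M hM
    have := (hP M hM).1 (2 * k + 3) (by omega)
    unfold cexA cexE at this
    omega
  have hz : ∀ M, M.IsPerfectMatching → P M (2 * k + 3) = 2 * k + 2 →
      P M 0 = 1 ∨ P M 0 = 2 * k + 1 := by
    intro M hM h
    have h1 := (hP M hM).1 (2 * k + 3) (by omega)
    have h2 := (hP M hM).1 0 (by omega)
    rw [h] at h1
    have h4 : P M 0 ≠ 2 * k + 2 := by
      intro h'
      have h3 := h2.2.1
      rw [h'] at h3
      have := h1.2.1
      omega
    unfold cexA cexE at h2
    omega
  have hcard : (↑(insert (2 * k + 2) (Finset.range (2 * k + 1))) : Set ℕ).ncard ≤ 2 * k + 2 := by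
    rw [Set.ncard_coe_finset]
    refine (Finset.card_insert_le _ _).trans ?_
    simp
  refine le_trans ?_ hcard
  unfold numPM
  refine Set.ncard_le_ncard_of_injOn key ?_ ?_ (Finset.finite_toSet _)
  · intro M hM
    have := hub M hM
    simp only [key, Finset.coe_insert, Set.mem_insert_iff, Finset.mem_coe, Finset.mem_range]
    split_ifs <;> omega
  · intro M hM M' hM' h
    obtain ⟨a1, a2⟩ := hP M hM
    obtain ⟨b1, b2⟩ := hP M' hM'
    have c1 := hub M hM
    have c2 := hub M' hM'
    have d1 := hz M hM
    have d2 := hz M' hM'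
    have hh : P M (2 * k + 3) = P M' (2 * k + 3) := by
      simp only [key] at h
      split_ifs at h <;> omega
    have h0 : P M 0 = P M' 0 := by
      rcases c1 with c | ⟨c, c'⟩
      · simp only [key] at h
        split_ifs at h <;> omega
      · have e1 := partner_parity k hk _ a1 _ c c' rfl
        have e2 := partner_parity k hk _ b1 _ c c' hh.symm
        omega
    have huniq := partner_unique k hk _ _ a1 b1 h0 hh
    apply SimpleGraph.Subgraph.ext
    · rw [hM.2.verts_eq_univ, hM'.2.verts_eq_univ]
    · ext a b
      rw [a2, b2, huniq a a.2]

/-- The conjecture of Lucchesi and Murty fails: for every positive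
integer `N` there exist an integer `n ≥ N` and a brick on `n` vertices with strictly
fewer than `n − 1` perfect matchings. -/
theorem stmt12 :
    ∀ N : ℕ, 0 < N → ∃ n : ℕ, N ≤ n ∧
      ∃ G : SimpleGraph (Fin n), IsBrick G ∧ numPM G < n - 1 := by
  intro N hN
  refine ⟨2 * N + 4, by omega, cexG N hN, ⟨⟨by simp, cex_connected N hN⟩, cex_bicritical N hN⟩, ?_⟩
  have := cex_numPM N hN
  omega
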